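/- Let (J_i)_{i∈B} be i.i.d. real random variables with E[J] = 0, E[J²] = 1, and E[e^{θ|J|}] < ∞ for some θ > 0. Let (a_i)_{i∈B} be reals with |a_i| ≤ θ/2 for all i. Then |E[exp((1/√|B|) Σ_i a_iJ_i)] − exp((1/(2|B|)) Σ_i a_i²)| ≤ (C/|B|^{3/2}) Σ_i |a_i|³, where C depends only on the law of J and θ. -/

import Mathlib

open MeasureTheory

lemma abs_exp_sub_sum_le (y : ℝ) (n : ℕ) :
    |Real.exp y - ∑ m ∈ Finset.range n, y ^ m / m.factorial| ≤ |y| ^ n * Real.exp |y| := by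
  have h := Complex.norm_exp_sub_sum_le_norm_mul_exp (y : ℂ) n
  have e : (Complex.exp y - ∑ m ∈ Finset.range n, (y : ℂ) ^ m / m.factorial)
      = ((Real.exp y - ∑ m ∈ Finset.range n, y ^ m / m.factorial : ℝ) : ℂ) := by
    push_cast; rfl
  rwa [e, Complex.norm_real, Complex.norm_real] at h

lemma abs_exp_sub_quadratic_le {θ t : ℝ} (hθ : 0 < θ) (ht : |t| ≤ θ / 2) (x : ℝ) :
    |Real.exp (t * x) - (1 + t * x + t ^ 2 / 2 * x ^ 2)|
      ≤ |t| ^ 3 * (48 / θ ^ 3) * Real.exp (θ * |x|) := by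
  have h := abs_exp_sub_sum_le (t * x) 3
  simp only [Finset.sum_range_succ, Finset.sum_range_zero, Nat.factorial] at h
  norm_num at h
  have h1 : |t| * |x| ≤ θ / 2 * |x| := by gcongr
  have h2 : (θ / 2 * |x|) ^ 3 / (Nat.factorial 3 : ℝ) ≤ Real.exp (θ / 2 * |x|) :=
    Real.pow_div_factorial_le_exp _ (by positivity) 3
  have h3 : |x| ^ 3 ≤ 48 / θ ^ 3 * Real.exp (θ / 2 * |x|) := by
    norm_num [Nat.factorial] at h2
    rw [div_mul_eq_mul_div, le_div_iff₀ (by positivity)]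
    nlinarith
  calc _ = |Real.exp (t * x) - (1 + t * x + (t * x) ^ 2 / 2)| := by congr 1; ring
    _ ≤ (|t| * |x|) ^ 3 * Real.exp (|t| * |x|) := h
    _ = |t| ^ 3 * |x| ^ 3 * Real.exp (|t| * |x|) := by ring
    _ ≤ |t| ^ 3 * (48 / θ ^ 3 * Real.exp (θ / 2 * |x|)) * Real.exp (θ / 2 * |x|) := by gcongr
    _ = |t| ^ 3 * (48 / θ ^ 3) * (Real.exp (θ / 2 * |x|) * Real.exp (θ / 2 * |x|)) := by ring
    _ = _ := by rw [← Real.exp_add]; ring_nf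

lemma abs_prod_sub_prod_le {ι : Type*} (s : Finset ι) (u v w : ι → ℝ)
    (hu : ∀ i ∈ s, |u i| ≤ w i) (hv : ∀ i ∈ s, |v i| ≤ w i) (hw : ∀ i ∈ s, 1 ≤ w i) :
    |∏ i ∈ s, u i - ∏ i ∈ s, v i| ≤ (∏ i ∈ s, w i) * ∑ i ∈ s, |u i - v i| := by
  classical
  induction s using Finset.induction_on with
  | empty => simp
  | insert i s hi ih =>
    simp only [Finset.forall_mem_insert] at hu hv hw
    have ih := ih hu.2 hv.2 hw.2
    rw [Finset.prod_insert hi, Finset.prod_insert hi, Finset.prod_insert hi, Finset.sum_insert hi]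
    have hU : |∏ j ∈ s, u j| ≤ ∏ j ∈ s, w j := by
      rw [Finset.abs_prod]
      exact Finset.prod_le_prod (fun _ _ => abs_nonneg _) hu.2
    have hW : 0 ≤ ∏ j ∈ s, w j := (abs_nonneg _).trans hU
    calc _ = |(u i - v i) * ∏ j ∈ s, u j + v i * (∏ j ∈ s, u j - ∏ j ∈ s, v j)| := by
          congr 1; ring
      _ ≤ |u i - v i| * |∏ j ∈ s, u j| + |v i| * |∏ j ∈ s, u j - ∏ j ∈ s, v j| := by
          rw [← abs_mul, ← abs_mul]; exact abs_add_le _ _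
      _ ≤ |u i - v i| * (w i * ∏ j ∈ s, w j)
            + w i * ((∏ j ∈ s, w j) * ∑ j ∈ s, |u j - v j|) := by
          have := le_mul_of_one_le_left hW hw.1
          have := zero_le_one.trans hw.1
          gcongr
          · exact hU.trans ‹_›
          · exact hv.1
      _ = _ := by ring

lemma abs_mgf_sub_quadratic_le {θ : ℝ} (hθ : 0 < θ) {ν : Measure ℝ} [IsProbabilityMeasure ν]
    (hmean : ∫ x, x ∂ν = 0) (hvar : ∫ x, x ^ 2 ∂ν = 1)
    (hexp : Integrable (fun x => Real.exp (θ * |x|)) ν) {t : ℝ} (ht : |t| ≤ θ / 2) :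
    |∫ x, Real.exp (t * x) ∂ν - (1 + t ^ 2 / 2)|
      ≤ |t| ^ 3 * (48 / θ ^ 3) * ∫ x, Real.exp (θ * |x|) ∂ν := by
  have hx2 : Integrable (fun x : ℝ => x ^ 2) ν :=
    Integrable.of_integral_ne_zero (by rw [hvar]; exact one_ne_zero)
  have hx : Integrable (fun x : ℝ => x) ν := by
    have : MemLp (fun x : ℝ => x) 2 ν := (memLp_two_iff_integrable_sq (by fun_prop)).2 hx2
    exact this.integrable (by norm_num)
  have het : Integrable (fun x => Real.exp (t * x)) ν := by
    refine hexp.mono' (by fun_prop) (.of_forall fun x => ?_)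
    rw [Real.norm_eq_abs, Real.abs_exp, Real.exp_le_exp]
    calc t * x ≤ |t| * |x| := (le_abs_self _).trans (abs_mul _ _).le
      _ ≤ θ * |x| := by gcongr; linarith
  have h1 : Integrable (fun x : ℝ => 1 + t * x) ν := (integrable_const 1).add (hx.const_mul t)
  have hq : Integrable (fun x : ℝ => 1 + t * x + t ^ 2 / 2 * x ^ 2) ν := h1.add (hx2.const_mul _)
  have hqi : ∫ x, (1 + t * x + t ^ 2 / 2 * x ^ 2) ∂ν = 1 + t ^ 2 / 2 := by
    rw [integral_add h1 (hx2.const_mul _), integral_add (integrable_const 1) (hx.const_mul t),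
      integral_const_mul, integral_const_mul, hmean, hvar]
    simp
  rw [← hqi, ← integral_sub het hq, ← integral_const_mul]
  rw [← Real.norm_eq_abs]
  refine norm_integral_le_of_norm_le (hexp.const_mul _) (.of_forall fun x => ?_)
  exact abs_exp_sub_quadratic_le hθ ht x

lemma abs_exp_half_sq_sub_quadratic_le {θ t : ℝ} (ht : |t| ≤ θ / 2) :
    |Real.exp (t ^ 2 / 2) - (1 + t ^ 2 / 2)| ≤ |t| ^ 3 * (θ / 8 * Real.exp (θ ^ 2 / 8)) := by
  have h := abs_exp_sub_sum_le (t ^ 2 / 2) 2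
  simp only [Finset.sum_range_succ, Finset.sum_range_zero, Nat.factorial] at h
  norm_num at h
  rw [abs_of_nonneg (by positivity : 0 ≤ t ^ 2 / 2)] at h
  have hsq : |t| ^ 2 ≤ (θ / 2) ^ 2 := by gcongr
  calc _ ≤ (t ^ 2 / 2) ^ 2 * Real.exp (t ^ 2 / 2) := h
    _ = |t| ^ 3 * (|t| / 4 * Real.exp (|t| ^ 2 / 2)) := by rw [← sq_abs t]; ring
    _ ≤ |t| ^ 3 * (θ / 8 * Real.exp (θ ^ 2 / 8)) := by
      gcongr ?_ * (?_ * Real.exp ?_)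
      · linarith [abs_nonneg t]
      · linarith
      · linarith

theorem stmt_13 (θ : ℝ) (hθ : 0 < θ) (ν : Measure ℝ) [IsProbabilityMeasure ν]
    (hmean : ∫ x, x ∂ν = 0) (hvar : ∫ x, x ^ 2 ∂ν = 1)
    (hexp : Integrable (fun x => Real.exp (θ * |x|)) ν) :
    ∃ C : ℝ, 0 < C ∧ ∀ (n : ℕ), 0 < n → ∀ a : Fin n → ℝ, (∀ i, |a i| ≤ θ / 2) →
      |(∫ x, Real.exp ((1 / Real.sqrt n) * ∑ i, a i * x i)
          ∂(Measure.pi fun _ : Fin n => ν))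
          - Real.exp ((1 / (2 * n)) * ∑ i, (a i) ^ 2)|
        ≤ C / (n : ℝ) ^ ((3 : ℝ) / 2) * ∑ i, |a i| ^ 3 := by
  set A : ℝ := 48 / θ ^ 3 * ∫ x, Real.exp (θ * |x|) ∂ν with hA
  set B : ℝ := θ / 8 * Real.exp (θ ^ 2 / 8) with hB
  have hA0 : 0 ≤ A := mul_nonneg (by positivity) (integral_nonneg fun x => (Real.exp_pos _).le)
  have hB0 : 0 < B := by positivity
  set D : ℝ := 1 / 2 + A * (θ / 2) with hD
  refine ⟨Real.exp (D * (θ / 2) ^ 2) * (A + B), by positivity, fun n hn a ha => ?_⟩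
  have hn1 : (1 : ℝ) ≤ n := by exact_mod_cast hn
  have hs : 1 ≤ √(n : ℝ) := Real.one_le_sqrt.2 hn1
  have hs0 : 0 < √(n : ℝ) := zero_lt_one.trans_le hs
  have hss : √(n : ℝ) ^ 2 = n := Real.sq_sqrt (by positivity)
  have hs3 : (n : ℝ) ^ ((3 : ℝ) / 2) = √(n : ℝ) ^ 3 := by
    rw [Real.sqrt_eq_rpow, ← Real.rpow_natCast, ← Real.rpow_mul (by positivity)]
    norm_num
  set t : Fin n → ℝ := fun i => a i / √(n : ℝ) with ht_def
  have hta (i) : |t i| = |a i| / √(n : ℝ) := by rw [ht_def, abs_div, abs_of_pos hs0]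
  have ht (i) : |t i| ≤ θ / 2 := by
    rw [hta]; exact (div_le_self (abs_nonneg _) hs).trans (ha i)
  have hM (i) : |∫ x, Real.exp (t i * x) ∂ν - (1 + t i ^ 2 / 2)| ≤ |t i| ^ 3 * A := by
    rw [hA, ← mul_assoc]; exact abs_mgf_sub_quadratic_le hθ hmean hvar hexp (ht i)
  have hG (i) : |Real.exp (t i ^ 2 / 2) - (1 + t i ^ 2 / 2)| ≤ |t i| ^ 3 * B :=
    abs_exp_half_sq_sub_quadratic_le (ht i)
  have hMG (i) : |∫ x, Real.exp (t i * x) ∂ν - Real.exp (t i ^ 2 / 2)|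
      ≤ |t i| ^ 3 * (A + B) := by
    have := abs_sub_le (∫ x, Real.exp (t i * x) ∂ν) (1 + t i ^ 2 / 2) (Real.exp (t i ^ 2 / 2))
    rw [abs_sub_comm (1 + t i ^ 2 / 2)] at this
    linarith [hM i, hG i]
  have hMw (i) : |∫ x, Real.exp (t i * x) ∂ν| ≤ Real.exp (D * t i ^ 2) := by
    rw [abs_of_nonneg (integral_nonneg fun x => (Real.exp_pos _).le)]
    have h1 := (abs_le.1 (hM i)).2
    have h2 : |t i| ^ 3 * A ≤ t i ^ 2 * (θ / 2) * A := by
      rw [pow_succ, sq_abs]; gcongr; exact ht i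
    have h3 := Real.add_one_le_exp (D * t i ^ 2)
    rw [hD] at h3 ⊢
    linarith
  have hGw (i) : |Real.exp (t i ^ 2 / 2)| ≤ Real.exp (D * t i ^ 2) := by
    rw [Real.abs_exp, Real.exp_le_exp, hD]
    have : 0 ≤ A * (θ / 2) * t i ^ 2 := by positivity
    linarith
  have hw (i) : 1 ≤ Real.exp (D * t i ^ 2) := Real.one_le_exp (by positivity)
  have hint : ∫ x, Real.exp ((1 / √(n : ℝ)) * ∑ i, a i * x i) ∂(Measure.pi fun _ : Fin n => ν)
      = ∏ i, ∫ x, Real.exp (t i * x) ∂ν := by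
    rw [← integral_fintype_prod_eq_prod]
    congr 1 with x
    rw [← Real.exp_sum, Finset.mul_sum]
    congr 1
    exact Finset.sum_congr rfl fun i _ => by rw [ht_def]; ring
  have hgauss : Real.exp ((1 / (2 * n)) * ∑ i, a i ^ 2) = ∏ i, Real.exp (t i ^ 2 / 2) := by
    rw [← Real.exp_sum, Finset.mul_sum]
    congr 1
    refine Finset.sum_congr rfl fun i _ => ?_
    rw [ht_def, div_pow, hss]
    field_simp
  have hprod : ∏ i, Real.exp (D * t i ^ 2) ≤ Real.exp (D * (θ / 2) ^ 2) := by
    rw [← Real.exp_sum, Real.exp_le_exp, ← Finset.mul_sum]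
    gcongr
    calc ∑ i, t i ^ 2 ≤ ∑ _i : Fin n, (θ / 2) ^ 2 / n := by
          refine Finset.sum_le_sum fun i _ => ?_
          rw [← sq_abs, hta, div_pow, hss]
          gcongr
          exact ha i
      _ = (θ / 2) ^ 2 := by
          rw [Finset.sum_const, Finset.card_univ, Fintype.card_fin, nsmul_eq_mul]
          field_simp
  rw [hint, hgauss]
  calc _ ≤ (∏ i, Real.exp (D * t i ^ 2))
          * ∑ i, |∫ x, Real.exp (t i * x) ∂ν - Real.exp (t i ^ 2 / 2)| :=
        abs_prod_sub_prod_le _ _ _ _ (fun i _ => hMw i) (fun i _ => hGw i) fun i _ => hw i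
    _ ≤ Real.exp (D * (θ / 2) ^ 2) * ∑ i, |t i| ^ 3 * (A + B) := by
        gcongr with i
        exact hMG i
    _ = _ := by
        rw [hs3, ← Finset.sum_mul]
        simp_rw [hta, div_pow]
        rw [← Finset.sum_div]
        ring
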